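/- The modular j-function satisfies j = psi5 + 750 + 196875·phi5 + 20312500·phi5² + 615234375·phi5³ + 7324218750·phi5⁴ + 30517578125·phi5⁵, where psi5(z) = (η(z)/η(5z))^6 and phi5 = 1/psi5. -/

import Mathlib

open Complex UpperHalfPlane

noncomputable def qq (z : ℂ) : ℂ := Complex.exp (2 * Real.pi * Complex.I * z)

noncomputable def dedekindEta (z : ℂ) : ℂ :=
  Complex.exp (Real.pi * Complex.I * z / 12) * ∏' n : ℕ, (1 - qq ((n + 1) * z))

def sigma' (k n : ℕ) : ℕ := ∑ d ∈ n.divisors, d ^ k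

noncomputable def E4 (z : ℂ) : ℂ := 1 + 240 * ∑' n : ℕ, (sigma' 3 (n + 1) : ℂ) * qq z ^ (n + 1)

noncomputable def Δfun (z : ℂ) : ℂ := dedekindEta z ^ 24

noncomputable def jfun (z : ℂ) : ℂ := E4 z ^ 3 / Δfun z

noncomputable def psi5 (z : ℂ) : ℂ := (dedekindEta z / dedekindEta (5 * z)) ^ 6

noncomputable def phi5 (z : ℂ) : ℂ := (psi5 z)⁻¹

open Filter Topology Asymptotics

/-- The Euler product `∏ (1 - q ^ (n + 1))`. -/
noncomputable def eulerProd (q : ℂ) : ℂ := ∏' n : ℕ, (1 - q ^ (n + 1))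

/-- The `q`-series of the normalised Eisenstein series of weight `4`. -/
noncomputable def eisSeries (q : ℂ) : ℂ :=
  1 + 240 * ∑' n : ℕ, (sigma' 3 (n + 1) : ℂ) * q ^ (n + 1)

theorem norm_tprod_one_sub_pow_sub_one_le {q : ℂ} (hq : ‖q‖ ≤ 1 / 2) (k : ℕ) :
    ‖∏' n : ℕ, (1 - q ^ (n + k)) - 1‖ ≤ Real.exp (2 * ‖q‖ ^ k) - 1 := by
  have hs : Summable fun n : ℕ => ‖q‖ ^ (n + k) :=
    (summable_nat_add_iff k).mpr (summable_geometric_of_lt_one (norm_nonneg _) (by linarith))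
  have hm : Multipliable fun n : ℕ => 1 - q ^ (n + k) := by
    simp only [sub_eq_add_neg]
    exact multipliable_one_add_of_summable (by simpa using hs)
  refine le_of_tendsto ((hm.hasProd.sub_const 1).norm : Tendsto _ atTop _)
    (Eventually.of_forall fun s => ?_)
  simp only [sub_eq_add_neg (1 : ℂ) (_ ^ _)]
  refine (s.norm_prod_one_add_sub_one_le _).trans ?_
  gcongr
  simp only [norm_neg, norm_pow]
  refine (hs.sum_le_tsum s fun _ _ => by positivity).trans ?_
  simp only [pow_add, tsum_mul_right]
  rw [tsum_geometric_of_lt_one (norm_nonneg _) (by linarith)]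
  gcongr
  rw [inv_le_comm₀ (by linarith) (by norm_num)]
  linarith

theorem tprod_one_sub_pow_sub_one_isBigO (k : ℕ) :
    (fun q : ℂ => ∏' n : ℕ, (1 - q ^ (n + k)) - 1) =O[𝓝 0] fun q => q ^ k := by
  refine IsBigO.of_bound (2 * Real.exp 2) ?_
  filter_upwards [Metric.closedBall_mem_nhds (0 : ℂ) (by norm_num : (0 : ℝ) < 1 / 2)] with q hq
  have hq : ‖q‖ ≤ 1 / 2 := by simpa using hq
  refine (norm_tprod_one_sub_pow_sub_one_le hq k).trans ?_
  have hx : ‖q‖ ^ k ≤ 1 := pow_le_one₀ (norm_nonneg _) (by linarith)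
  have hx0 : 0 ≤ ‖q‖ ^ k := by positivity
  rw [norm_pow]
  set x := ‖q‖ ^ k
  have h1 : 1 - 2 * x ≤ Real.exp (-(2 * x)) := by linarith [Real.add_one_le_exp (-(2 * x))]
  have h2 : Real.exp (2 * x) * Real.exp (-(2 * x)) = 1 := by rw [← Real.exp_add]; simp
  have h3 : Real.exp (2 * x) ≤ Real.exp 2 := Real.exp_le_exp.mpr (by linarith)
  nlinarith [Real.exp_pos (2 * x)]

/-- Congruence of functions of `q` near `0`, modulo `q ^ n`. -/
def QModEq (n : ℕ) (f g : ℂ → ℂ) : Prop := (fun q => f q - g q) =O[𝓝 0] fun q => q ^ n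

namespace QModEq

variable {n : ℕ} {f g h f' g' : ℂ → ℂ}

theorem trans (hfg : QModEq n f g) (hgh : QModEq n g h) : QModEq n f h :=
  (IsBigO.add hfg hgh).congr_left fun q => by ring

theorem add (hf : QModEq n f f') (hg : QModEq n g g') :
    QModEq n (fun q => f q + g q) fun q => f' q + g' q :=
  (IsBigO.add hf hg).congr_left fun q => by ring

theorem sub (hf : QModEq n f f') (hg : QModEq n g g') :
    QModEq n (fun q => f q - g q) fun q => f' q - g' q :=
  (IsBigO.sub hf hg).congr_left fun q => by ring

theorem refl (n : ℕ) (f : ℂ → ℂ) : QModEq n f f := by simp [QModEq, isBigO_zero]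

theorem of_eq_add_pow_mul {k : ℂ → ℂ} (hk : Continuous k) (h : ∀ q, f q = g q + q ^ n * k q) :
    QModEq n f g := by
  have : (fun q : ℂ => q ^ n * k q) =O[𝓝 0] fun q => q ^ n * (1 : ℂ) :=
    (isBigO_refl _ _).mul (hk.continuousAt.isBigO_one ℂ)
  simpa [QModEq, h] using this

theorem isBigO_one (hf : QModEq n f f') (hf' : Continuous f') : f =O[𝓝 0] fun _ => (1 : ℂ) := by
  have h1 : (fun q : ℂ => q ^ n) =O[𝓝 0] fun _ => (1 : ℂ) :=
    (continuous_pow n).continuousAt.isBigO_one ℂ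
  exact ((IsBigO.trans hf h1).add (hf'.continuousAt.isBigO_one ℂ)).congr_left fun q => by ring

theorem mul (hf : QModEq n f f') (hg : QModEq n g g') (hcf : Continuous f')
    (hcg : Continuous g') : QModEq n (fun q => f q * g q) fun q => f' q * g' q := by
  have h1 := IsBigO.mul hf (hg.isBigO_one hcg)
  have h2 := IsBigO.mul (hcf.continuousAt.isBigO_one ℂ) hg
  simp only [mul_one, one_mul] at h1 h2
  exact (h1.add h2).congr_left fun q => by ring

theorem pow (hf : QModEq n f f') (hcf : Continuous f') (m : ℕ) :
    QModEq n (fun q => f q ^ m) fun q => f' q ^ m := by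
  induction m with
  | zero => simpa using refl n _
  | succ m ih => simpa only [pow_succ] using ih.mul hf (hcf.pow m) hcf

theorem comp_pow (hf : QModEq n f f') {m : ℕ} (hm : m ≠ 0) :
    QModEq (m * n) (fun q => f (q ^ m)) fun q => f' (q ^ m) := by
  have : Tendsto (fun q : ℂ => q ^ m) (𝓝 0) (𝓝 0) := by
    simpa [hm] using (continuous_pow (M := ℂ) m).tendsto 0
  simpa [QModEq, Function.comp_def, ← pow_mul] using IsBigO.comp_tendsto hf this

theorem mono {m : ℕ} (hf : QModEq n f f') (h : m ≤ n) : QModEq m f f' := by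
  refine IsBigO.trans hf ?_
  obtain ⟨k, rfl⟩ := Nat.exists_eq_add_of_le h
  simpa [pow_add] using (isBigO_refl (fun q : ℂ => q ^ m) (𝓝 0)).mul
    ((continuous_pow k).continuousAt.isBigO_one ℂ)

end QModEq

theorem multipliable_one_sub_pow_add {q : ℂ} (hq : ‖q‖ < 1) (k : ℕ) :
    Multipliable fun n : ℕ => 1 - q ^ (n + k) := by
  simp only [sub_eq_add_neg]
  refine multipliable_one_add_of_summable ?_
  simpa using (summable_nat_add_iff k).mpr (summable_geometric_of_lt_one (norm_nonneg q) hq)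

theorem eulerProd_eq_prod_mul_tprod {q : ℂ} (hq : ‖q‖ < 1) :
    eulerProd q = (1 - q) * (1 - q ^ 2) * (1 - q ^ 3) * (1 - q ^ 4) * (1 - q ^ 5) *
      ∏' n : ℕ, (1 - q ^ (n + 6)) := by
  have h := fun k => tprod_eq_zero_mul' (f := fun n : ℕ => 1 - q ^ (n + k))
    (by simpa only [add_assoc] using multipliable_one_sub_pow_add hq (1 + k))
  simp only [zero_add, add_assoc] at h
  rw [eulerProd, h 1, h (1 + 1), h (1 + (1 + 1)), h (1 + (1 + (1 + 1))),
    h (1 + (1 + (1 + (1 + 1))))]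
  norm_num [mul_assoc]

theorem eulerProd_qModEq : QModEq 6 eulerProd fun q => 1 - q - q ^ 2 + q ^ 5 := by
  have h1 : QModEq 6 (fun q => ∏' n : ℕ, (1 - q ^ (n + 6))) fun _ => 1 :=
    tprod_one_sub_pow_sub_one_isBigO 6
  have h2 := (QModEq.refl 6 fun q : ℂ =>
    (1 - q) * (1 - q ^ 2) * (1 - q ^ 3) * (1 - q ^ 4) * (1 - q ^ 5)).mul h1
    (by fun_prop) (by fun_prop)
  have h3 : QModEq 6 eulerProd fun q =>
      (1 - q) * (1 - q ^ 2) * (1 - q ^ 3) * (1 - q ^ 4) * (1 - q ^ 5) * 1 := by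
    refine IsBigO.congr' h2 ?_ .rfl
    filter_upwards [Metric.ball_mem_nhds (0 : ℂ) one_pos] with q hq
    rw [eulerProd_eq_prod_mul_tprod (by simpa using hq)]
  refine h3.trans
    (QModEq.of_eq_add_pow_mul
    (k := fun q => 1 + q - q ^ 2 - q ^ 3 - q ^ 4 + q ^ 7 + q ^ 8 - q ^ 9) (by fun_prop) fun q => ?_)
  ring

theorem sigma'_le (n : ℕ) : sigma' 3 n ≤ n ^ 4 := by
  have h := ArithmeticFunction.sigma_le_pow_succ 3 n
  rwa [ArithmeticFunction.sigma_apply] at h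

theorem summable_sigma'_mul_pow {r : ℝ} (h0 : 0 ≤ r) (h1 : r < 1) :
    Summable fun n : ℕ => (sigma' 3 n : ℝ) * r ^ n := by
  refine .of_nonneg_of_le (fun n => by positivity) (fun n => ?_)
    (summable_pow_mul_geometric_of_norm_lt_one 4 (r := r) (by rwa [Real.norm_of_nonneg h0]))
  gcongr
  exact_mod_cast sigma'_le n

theorem summable_sigma'_mul_pow_complex {q : ℂ} (hq : ‖q‖ < 1) :
    Summable fun n : ℕ => (sigma' 3 n : ℂ) * q ^ n := by
  refine Summable.of_norm ?_
  simpa using summable_sigma'_mul_pow (norm_nonneg q) hq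

theorem eisSeries_qModEq : QModEq 2 eisSeries fun q => 1 + 240 * q := by
  have hs : Summable fun n : ℕ => (sigma' 3 (n + 2) : ℝ) * (1 / 2) ^ n := by
    have := (summable_nat_add_iff 2).mpr
      (summable_sigma'_mul_pow (r := 1 / 2) (by norm_num) (by norm_num))
    refine (this.mul_left 4).congr fun n => ?_
    ring
  have h1 : (fun q : ℂ => ∑' n : ℕ, (sigma' 3 (n + 2) : ℂ) * q ^ n) =O[𝓝 0]
      fun _ => (1 : ℂ) := by
    refine IsBigO.of_bound (∑' n : ℕ, (sigma' 3 (n + 2) : ℝ) * (1 / 2) ^ n) ?_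
    filter_upwards [Metric.closedBall_mem_nhds (0 : ℂ) (by norm_num : (0 : ℝ) < 1 / 2)] with q hq
    have hq : ‖q‖ ≤ 1 / 2 := by simpa using hq
    simp only [norm_one, mul_one]
    refine tsum_of_norm_bounded hs.hasSum fun n => ?_
    simp only [norm_mul, norm_pow, Complex.norm_natCast]
    gcongr
  have h2 := ((isBigO_refl (fun q : ℂ => q ^ 2) (𝓝 0)).mul h1).const_mul_left 240
  simp only [mul_one] at h2
  refine IsBigO.congr' h2 ?_ .rfl
  filter_upwards [Metric.ball_mem_nhds (0 : ℂ) one_pos] with q hq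
  have hq : ‖q‖ < 1 := by simpa using hq
  rw [eisSeries,
    ((summable_nat_add_iff 1).mpr (summable_sigma'_mul_pow_complex hq)).tsum_eq_zero_add]
  have : ∀ n : ℕ, (sigma' 3 (n + 1 + 1) : ℂ) * q ^ (n + 1 + 1) =
      q ^ 2 * ((sigma' 3 (n + 2) : ℂ) * q ^ n) := fun n => by ring_nf
  simp only [this, tsum_mul_left]
  simp [sigma']
  ring

theorem eulerProd_pow_six_qModEq :
    QModEq 6 (fun q => eulerProd q ^ 6)
      fun q => 1 - 6 * q + 9 * q ^ 2 + 10 * q ^ 3 - 30 * q ^ 4 := by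
  refine (eulerProd_qModEq.pow (by fun_prop) 6).trans
    (QModEq.of_eq_add_pow_mul
    (k := fun q => 11 + 36 * q + 30 * q ^ 2 - 100 * q ^ 3 - 42 * q ^ 4 + 36 * q ^ 5 + 91 * q ^ 6 +
        90 * q ^ 7 - 105 * q ^ 8 - 106 * q ^ 9 - 30 * q ^ 10 + 60 * q ^ 11 + 115 * q ^ 12 - 45 * q ^
        14 - 50 * q ^ 15 - 15 * q ^ 16 + 30 * q ^ 17 + 15 * q ^ 18 + 6 * q ^ 19 - 6 * q ^ 20 -
        6 * q ^ 21 + q ^ 24)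
    (by fun_prop) fun q => ?_)
  ring

theorem eulerProd_comp_pow_five_qModEq :
    QModEq 6 (fun q => eulerProd (q ^ 5)) fun q => 1 - q ^ 5 := by
  refine ((eulerProd_qModEq.comp_pow (m := 5) (by norm_num)).mono (by norm_num)).trans
    (QModEq.of_eq_add_pow_mul
    (k := fun q => -q ^ 4 + q ^ 19)
    (by fun_prop) fun q => ?_)
  ring

theorem eulerProd_comp_pow_five_pow_six_qModEq :
    QModEq 6 (fun q => eulerProd (q ^ 5) ^ 6) fun q => 1 - 6 * q ^ 5 := by
  refine (eulerProd_comp_pow_five_qModEq.pow (by fun_prop) 6).trans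
    (QModEq.of_eq_add_pow_mul
    (k := fun q => 15 * q ^ 4 - 20 * q ^ 9 + 15 * q ^ 14 - 6 * q ^ 19 + q ^ 24)
    (by fun_prop) fun q => ?_)
  ring

theorem eisSeries_mul_qModEq_infty :
    QModEq 2 (fun q => eisSeries q ^ 3 * eulerProd q ^ 6 * eulerProd (q ^ 5) ^ 6)
      fun q => 1 + 714 * q := by
  refine (((eisSeries_qModEq.pow (by fun_prop) 3).mul
    (eulerProd_pow_six_qModEq.mono (by norm_num)) (by fun_prop) (by fun_prop)).mul
    (eulerProd_comp_pow_five_pow_six_qModEq.mono (by norm_num)) (by fun_prop) (by fun_prop)).trans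
    (QModEq.of_eq_add_pow_mul
    (k := fun q => 168489 + 12793690 * q - 81381630 * q ^ 2 + 126122394 * q ^ 3 + 133051716 * q ^ 4 -
        415730934 * q ^ 5 - 76762140 * q ^ 6 + 488289780 * q ^ 7 - 756734400 * q ^ 8 -
        798336000 * q ^ 9 + 2488320000 * q ^ 10)
    (by fun_prop) fun q => ?_)
  ring

theorem quadratic_qModEq_infty :
    QModEq 2 (fun q => ((eulerProd q ^ 6) ^ 2 + 250 * q * (eulerProd q ^ 6 * eulerProd (q ^ 5) ^ 6)
      + 3125 * q ^ 2 * (eulerProd (q ^ 5) ^ 6) ^ 2)) fun q => 1 + 238 * q := by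
  refine (((((eulerProd_pow_six_qModEq.mono (by norm_num)).pow (by fun_prop) 2).add
    ((QModEq.refl 2 fun q => 250 * q).mul
      ((eulerProd_pow_six_qModEq.mono (by norm_num)).mul
        (eulerProd_comp_pow_five_pow_six_qModEq.mono (by norm_num)) (by fun_prop) (by fun_prop))
      (by fun_prop) (by fun_prop))).add
    ((QModEq.refl 2 fun q => 3125 * q ^ 2).mul
      ((eulerProd_comp_pow_five_pow_six_qModEq.mono (by norm_num)).pow (by fun_prop) 2) (by fun_prop)
      (by fun_prop)))).trans
    (QModEq.of_eq_add_pow_mul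
    (k := fun q => 1679 + 2162 * q + 2401 * q ^ 2 - 6960 * q ^ 3 - 1940 * q ^ 4 - 29100 * q ^ 5 - 12600 *
        q ^ 6 - 15000 * q ^ 7 + 45000 * q ^ 8 + 112500 * q ^ 10)
    (by fun_prop) fun q => ?_)
  ring

theorem quadratic_pow_three_qModEq_infty :
    QModEq 2 (fun q => ((eulerProd q ^ 6) ^ 2 + 250 * q * (eulerProd q ^ 6 * eulerProd (q ^ 5) ^ 6)
      + 3125 * q ^ 2 * (eulerProd (q ^ 5) ^ 6) ^ 2) ^ 3) fun q => 1 + 714 * q := by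
  refine (quadratic_qModEq_infty.pow (by fun_prop) 3).trans
    (QModEq.of_eq_add_pow_mul
    (k := fun q => 169932 + 13481272 * q)
    (by fun_prop) fun q => ?_)
  ring

theorem numerator_isBigO_infty :
    (fun q : ℂ => eisSeries q ^ 3 * eulerProd q ^ 6 * eulerProd (q ^ 5) ^ 6
      - ((eulerProd q ^ 6) ^ 2 + 250 * q * (eulerProd q ^ 6 * eulerProd (q ^ 5) ^ 6)
      + 3125 * q ^ 2 * (eulerProd (q ^ 5) ^ 6) ^ 2) ^ 3)
      =O[𝓝 0] fun q => q ^ 2 := by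
  have h := eisSeries_mul_qModEq_infty.sub quadratic_pow_three_qModEq_infty
  simpa only [QModEq, sub_self, sub_zero] using h

theorem eisSeries_mul_qModEq_zero :
    QModEq 6 (fun q => eisSeries (q ^ 5) ^ 3 * eulerProd q ^ 6 * eulerProd (q ^ 5) ^ 6)
      fun q => 1 - 6 * q + 9 * q ^ 2 + 10 * q ^ 3 - 30 * q ^ 4 + 714 * q ^ 5 := by
  refine (((((eisSeries_qModEq.comp_pow (m := 5) (by norm_num)).mono (m := 6)
    (by norm_num)).pow (by fun_prop) 3).mul
    eulerProd_pow_six_qModEq (by fun_prop) (by fun_prop)).mul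
    eulerProd_comp_pow_five_pow_six_qModEq (by fun_prop) (by fun_prop)).trans
    (QModEq.of_eq_add_pow_mul
    (k := fun q => -4284 + 6426 * q + 7140 * q ^ 2 - 21420 * q ^ 3 + 168480 * q ^ 4 - 1010880 * q ^ 5 +
        1516320 * q ^ 6 + 1684800 * q ^ 7 - 5054400 * q ^ 8 + 12787200 * q ^ 9 - 76723200 * q
        ^ 10 + 115084800 * q ^ 11 + 127872000 * q ^ 12 - 383616000 * q ^ 13 - 82944000 * q ^
        14 + 497664000 * q ^ 15 - 746496000 * q ^ 16 - 829440000 * q ^ 17 + 2488320000 * q ^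
        18)
    (by fun_prop) fun q => ?_)
  ring

theorem quadratic_qModEq_zero :
    QModEq 6 (fun q => ((eulerProd q ^ 6) ^ 2 + 10 * q * (eulerProd q ^ 6 * eulerProd (q ^ 5) ^ 6)
      + 5 * q ^ 2 * (eulerProd (q ^ 5) ^ 6) ^ 2))
      fun q => 1 - 2 * q - q ^ 2 + 2 * q ^ 3 + q ^ 4 + 240 * q ^ 5 := by
  refine ((((eulerProd_pow_six_qModEq.pow (by fun_prop) 2).add
    ((QModEq.refl 6 fun q => 10 * q).mul
      (eulerProd_pow_six_qModEq.mul eulerProd_comp_pow_five_pow_six_qModEq (by fun_prop)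
        (by fun_prop)) (by fun_prop) (by fun_prop))).add
    ((QModEq.refl 6 fun q => 5 * q ^ 2).mul
      (eulerProd_comp_pow_five_pow_six_qModEq.pow (by fun_prop) 2) (by fun_prop)
      (by fun_prop)))).trans
    (QModEq.of_eq_add_pow_mul
    (k := fun q => -500 - 300 * q + 360 * q ^ 2 - 600 * q ^ 3 + 1800 * q ^ 4 + 180 * q ^ 6)
    (by fun_prop) fun q => ?_)
  ring

theorem quadratic_pow_three_qModEq_zero :
    QModEq 6 (fun q => ((eulerProd q ^ 6) ^ 2 + 10 * q * (eulerProd q ^ 6 * eulerProd (q ^ 5) ^ 6)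
      + 5 * q ^ 2 * (eulerProd (q ^ 5) ^ 6) ^ 2) ^ 3)
      fun q => 1 - 6 * q + 9 * q ^ 2 + 10 * q ^ 3 - 30 * q ^ 4 + 714 * q ^ 5 := by
  refine (quadratic_qModEq_zero.pow (by fun_prop) 3).trans
    (QModEq.of_eq_add_pow_mul
    (k := fun q => -2839 + 1446 * q + 5730 * q ^ 2 - 3610 * q ^ 3 + 167049 * q ^ 4 - 344154 * q ^ 5 -
        169919 * q ^ 6 + 346320 * q ^ 7 + 172800 * q ^ 8 + 13824000 * q ^ 9)
    (by fun_prop) fun q => ?_)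
  ring

theorem numerator_isBigO_zero :
    (fun q : ℂ => eisSeries (q ^ 5) ^ 3 * eulerProd q ^ 6 * eulerProd (q ^ 5) ^ 6
      - ((eulerProd q ^ 6) ^ 2 + 10 * q * (eulerProd q ^ 6 * eulerProd (q ^ 5) ^ 6)
      + 5 * q ^ 2 * (eulerProd (q ^ 5) ^ 6) ^ 2) ^ 3)
      =O[𝓝 0] fun q => q ^ 6 := by
  have h := eisSeries_mul_qModEq_zero.sub quadratic_pow_three_qModEq_zero
  simpa only [QModEq, sub_self, sub_zero] using h

theorem eulerProd_tendsto_one : Tendsto eulerProd (𝓝 0) (𝓝 1) := by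
  have h := (ModularForm.differentiableOn_tprod_one_sub_pow.differentiableAt
    (Metric.ball_mem_nhds (0 : ℂ) one_pos)).continuousAt.tendsto
  have h0 : eulerProd 0 = 1 := by simp [eulerProd]
  rwa [← h0]

theorem eulerProd_comp_pow_five_tendsto_one :
    Tendsto (fun q : ℂ => eulerProd (q ^ 5)) (𝓝 0) (𝓝 1) :=
  eulerProd_tendsto_one.comp (by simpa using (continuous_pow (M := ℂ) 5).tendsto 0)

theorem tendsto_div_pow_mul_of_isBigO {N D : ℂ → ℂ} {m : ℕ}
    (hN : N =O[𝓝 0] fun q => q ^ (m + 1)) (hD : Tendsto D (𝓝 0) (𝓝 1)) :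
    Tendsto (fun q => N q / (q ^ m * D q)) (𝓝 0) (𝓝 0) := by
  have h1 : (fun q => N q * (q ^ m)⁻¹) =O[𝓝 0] fun q : ℂ => q := by
    refine (hN.mul (isBigO_refl (fun q : ℂ => (q ^ m)⁻¹) _)).trans
      (IsBigO.of_bound 1 (Eventually.of_forall fun q => ?_))
    rcases eq_or_ne q 0 with rfl | hq
    · simp
    · rw [pow_succ', mul_assoc, mul_inv_cancel₀ (pow_ne_zero _ hq)]
      simp
  have h2 := (h1.trans_tendsto tendsto_id).mul (hD.inv₀ one_ne_zero)
  rw [zero_mul] at h2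
  refine h2.congr fun q => ?_
  rw [div_eq_mul_inv, mul_inv, mul_assoc]

theorem qq_ne_zero (z : ℂ) : qq z ≠ 0 := Complex.exp_ne_zero _

theorem qq_natCast_mul (n : ℕ) (z : ℂ) : qq (n * z) = qq z ^ n := by
  rw [qq, qq, ← Complex.exp_nat_mul]
  ring_nf

theorem qq_five_mul (z : ℂ) : qq (5 * z) = qq z ^ 5 := by
  exact_mod_cast qq_natCast_mul 5 z

theorem qq_add_intCast (z : ℂ) (n : ℤ) : qq (z + n) = qq z := by
  rw [qq, mul_add, Complex.exp_add, mul_comm _ (n : ℂ), Complex.exp_int_mul_two_pi_mul_I, mul_one]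
  rfl

theorem dedekindEta_eq_eulerProd (z : ℂ) :
    dedekindEta z = Complex.exp (Real.pi * Complex.I * z / 12) * eulerProd (qq z) := by
  simp only [dedekindEta, eulerProd]
  congr 2
  funext n
  rw [← qq_natCast_mul]
  push_cast
  rfl

theorem dedekindEta_eq_eta (z : ℂ) : dedekindEta z = ModularForm.eta z := by
  rw [dedekindEta_eq_eulerProd, ModularForm.eta, Function.Periodic.qParam, eulerProd]
  simp only [ModularForm.eta_q_eq_pow]
  congr 2
  push_cast
  ring

theorem eulerProd_ne_zero {z : ℂ} (hz : 0 < z.im) : eulerProd (qq z) ≠ 0 := by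
  have h := ModularForm.eta_ne_zero (z := z) hz
  rw [← dedekindEta_eq_eta, dedekindEta_eq_eulerProd] at h
  exact right_ne_zero_of_mul h

theorem dedekindEta_ne_zero {z : ℂ} (hz : 0 < z.im) : dedekindEta z ≠ 0 := by
  rw [dedekindEta_eq_eta]
  exact ModularForm.eta_ne_zero hz

theorem im_five_mul_pos {z : ℂ} (hz : 0 < z.im) : 0 < (5 * z).im := by
  simpa using hz

theorem psi5_eq_eulerProd (z : ℂ) :
    psi5 z = (eulerProd (qq z) / eulerProd (qq z ^ 5)) ^ 6 / qq z := by
  have h : qq z * Complex.exp (Real.pi * Complex.I * z / 12) ^ 6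
      = Complex.exp (Real.pi * Complex.I * (5 * z) / 12) ^ 6 := by
    rw [qq, ← Complex.exp_nat_mul, ← Complex.exp_nat_mul, ← Complex.exp_add]
    congr 1
    push_cast
    ring
  have h0 := Complex.exp_ne_zero (Real.pi * Complex.I * z / 12)
  rw [psi5, dedekindEta_eq_eulerProd, dedekindEta_eq_eulerProd, qq_five_mul, div_pow, mul_pow,
    mul_pow, ← h, div_pow]
  field_simp [qq_ne_zero z]

theorem psi5_ne_zero {z : ℂ} (hz : 0 < z.im) : psi5 z ≠ 0 :=
  pow_ne_zero _ (div_ne_zero (dedekindEta_ne_zero hz) (dedekindEta_ne_zero (im_five_mul_pos hz)))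

theorem jfun_eq_eulerProd (z : ℂ) :
    jfun z = eisSeries (qq z) ^ 3 / (qq z * eulerProd (qq z) ^ 24) := by
  have h : Complex.exp (Real.pi * Complex.I * z / 12) ^ 24 = qq z := by
    rw [qq, ← Complex.exp_nat_mul]
    congr 1
    push_cast
    ring
  rw [jfun, Δfun, dedekindEta_eq_eulerProd, mul_pow, h]
  rfl

/-- The rational function expressing `j` through the Hauptmodul of level `5`. -/
noncomputable def levelFiveMap (t : ℂ) : ℂ := (t ^ 2 + 250 * t + 3125) ^ 3 / t ^ 5

theorem jfun_sub_levelFiveMap_eq {z : ℂ} (hz : 0 < z.im) :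
    jfun z - levelFiveMap (psi5 z) =
      (eisSeries (qq z) ^ 3 * eulerProd (qq z) ^ 6 * eulerProd (qq z ^ 5) ^ 6
      - ((eulerProd (qq z) ^ 6) ^ 2
      + 250 * qq z * (eulerProd (qq z) ^ 6 * eulerProd (qq z ^ 5) ^ 6)
      + 3125 * qq z ^ 2 * (eulerProd (qq z ^ 5) ^ 6) ^ 2) ^ 3) /
      (qq z ^ 1 * (eulerProd (qq z) ^ 30 * eulerProd (qq z ^ 5) ^ 6)) := by
  have h1 := eulerProd_ne_zero hz
  have h2 := eulerProd_ne_zero (im_five_mul_pos hz)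
  rw [qq_five_mul] at h2
  have h3 := qq_ne_zero z
  rw [jfun_eq_eulerProd, psi5_eq_eulerProd, levelFiveMap]
  generalize eulerProd (qq z) = a at *
  generalize eulerProd (qq z ^ 5) = b at *
  generalize eisSeries (qq z) = c at *
  generalize qq z = q at *
  field_simp

theorem jfun_five_mul_sub_levelFiveMap_eq {z : ℂ} (hz : 0 < z.im) :
    jfun (5 * z) - levelFiveMap (125 / psi5 z) =
      (eisSeries (qq z ^ 5) ^ 3 * eulerProd (qq z) ^ 6 * eulerProd (qq z ^ 5) ^ 6
      - ((eulerProd (qq z) ^ 6) ^ 2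
      + 10 * qq z * (eulerProd (qq z) ^ 6 * eulerProd (qq z ^ 5) ^ 6)
      + 5 * qq z ^ 2 * (eulerProd (qq z ^ 5) ^ 6) ^ 2) ^ 3) /
      (qq z ^ 5 * (eulerProd (qq z) ^ 6 * eulerProd (qq z ^ 5) ^ 30)) := by
  have h1 := eulerProd_ne_zero hz
  have h2 := eulerProd_ne_zero (im_five_mul_pos hz)
  rw [qq_five_mul] at h2
  have h3 := qq_ne_zero z
  rw [jfun_eq_eulerProd, psi5_eq_eulerProd, levelFiveMap, qq_five_mul]
  generalize eulerProd (qq z) = a at *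
  generalize eulerProd (qq z ^ 5) = b at *
  generalize eisSeries (qq z ^ 5) = c at *
  generalize qq z = q at *
  field_simp
  ring

theorem tendsto_qq_atImInfty : Tendsto (fun z : ℍ => qq z) atImInfty (𝓝 0) := by
  simpa [Function.Periodic.qParam, qq] using
    UpperHalfPlane.qParam_tendsto_atImInfty (h := 1) one_pos

theorem tendsto_qq_div_five_atImInfty (k : ℂ) :
    Tendsto (fun z : ℍ => qq (((z : ℂ) + k) / 5)) atImInfty (𝓝 0) := by
  have h := (UpperHalfPlane.qParam_tendsto_atImInfty (h := 5) (by norm_num)).mul_const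
    (qq (k / 5))
  rw [zero_mul] at h
  refine h.congr fun z => ?_
  rw [Function.Periodic.qParam, qq, qq, ← Complex.exp_add]
  congr 1
  push_cast
  ring

theorem im_add_intCast_div_five_pos {z : ℂ} (hz : 0 < z.im) (k : ℤ) :
    0 < ((z + k) / 5).im := by
  have : ((z + k) / 5).im = z.im / 5 := by
    rw [show (5 : ℂ) = ((5 : ℝ) : ℂ) by norm_num, Complex.div_ofReal_im]
    simp
  rw [this]
  positivity

theorem tendsto_jfun_sub_levelFiveMap_infty :
    Tendsto (fun z : ℍ => jfun z - levelFiveMap (psi5 z)) atImInfty (𝓝 0) := by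
  have hD : Tendsto (fun q => eulerProd q ^ 30 * eulerProd (q ^ 5) ^ 6) (𝓝 0) (𝓝 1) := by
    simpa using (eulerProd_tendsto_one.pow 30).mul (eulerProd_comp_pow_five_tendsto_one.pow 6)
  refine ((tendsto_div_pow_mul_of_isBigO (m := 1) numerator_isBigO_infty hD).comp
    tendsto_qq_atImInfty).congr fun z => ?_
  exact (jfun_sub_levelFiveMap_eq z.im_pos).symm

theorem jfun_add_intCast (z : ℂ) (k : ℤ) : jfun (z + k) = jfun z := by
  rw [jfun_eq_eulerProd, jfun_eq_eulerProd, qq_add_intCast]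

theorem psi5_add_intCast (z : ℂ) (k : ℤ) : psi5 (z + k) = psi5 z := by
  rw [psi5_eq_eulerProd, psi5_eq_eulerProd, qq_add_intCast]

theorem tendsto_jfun_sub_levelFiveMap_zero (k : ℤ) :
    Tendsto (fun z : ℍ => jfun z - levelFiveMap (125 / psi5 ((z + k) / 5))) atImInfty (𝓝 0) := by
  have hD : Tendsto (fun q => eulerProd q ^ 6 * eulerProd (q ^ 5) ^ 30) (𝓝 0) (𝓝 1) := by
    simpa using (eulerProd_tendsto_one.pow 6).mul (eulerProd_comp_pow_five_tendsto_one.pow 30)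
  refine ((tendsto_div_pow_mul_of_isBigO (m := 5) numerator_isBigO_zero hD).comp
    (tendsto_qq_div_five_atImInfty k)).congr fun z => ?_
  have h := jfun_five_mul_sub_levelFiveMap_eq (im_add_intCast_div_five_pos z.im_pos k)
  rw [mul_div_cancel₀ _ (by norm_num : (5 : ℂ) ≠ 0), jfun_add_intCast] at h
  exact h.symm

/-! ### Modular transformations -/

theorem dedekindEta_pow_six_add_intCast (z : ℂ) (k : ℤ) :
    dedekindEta (z + k) ^ 6 = Complex.I ^ k * dedekindEta z ^ 6 := by
  rw [dedekindEta_eq_eulerProd, dedekindEta_eq_eulerProd, qq_add_intCast, mul_pow, mul_pow,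
    ← mul_assoc, ← Complex.exp_nat_mul, ← Complex.exp_nat_mul]
  congr 1
  rw [show Complex.I ^ k = Complex.exp (k * (Real.pi / 2 * Complex.I)) by
    rw [Complex.exp_int_mul, Complex.exp_pi_div_two_mul_I], ← Complex.exp_add]
  congr 1
  push_cast
  ring

theorem sqrt_pow_six (z : ℂ) : Complex.sqrt z ^ 6 = z ^ 3 := by
  have h : (z ^ (2⁻¹ : ℂ)) ^ 2 = z := by exact_mod_cast Complex.cpow_nat_inv_pow z two_ne_zero
  rw [show 6 = 2 * 3 by rfl, pow_mul, Complex.sqrt, h]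

theorem dedekindEta_pow_six_neg_inv {z : ℂ} (hz : 0 < z.im) :
    dedekindEta (-1 / z) ^ 6 = Complex.I * z ^ 3 * dedekindEta z ^ 6 := by
  have h : ModularForm.eta (-1 / z) = (Complex.sqrt Complex.I)⁻¹ *
      (Complex.sqrt z * ModularForm.eta z) := by
    simpa using! ModularForm.eta_comp_eq_csqrt_I_inv hz
  rw [dedekindEta_eq_eta, dedekindEta_eq_eta, h, mul_pow, mul_pow, inv_pow, sqrt_pow_six,
    sqrt_pow_six, Complex.I_pow_three, inv_neg, Complex.inv_I]
  ring
theorem im_neg_inv_pos {z : ℂ} (hz : 0 < z.im) : 0 < (-1 / z).im := by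
  simpa [neg_div, inv_neg] using (⟨z, hz⟩ : ℍ).im_inv_neg_coe_pos

theorem ne_zero_of_im_pos {z : ℂ} (hz : 0 < z.im) : z ≠ 0 := by
  rintro rfl
  simp at hz

theorem psi5_neg_inv_five_mul {z : ℂ} (hz : 0 < z.im) : psi5 (-1 / (5 * z)) = 125 / psi5 z := by
  have h0 := ne_zero_of_im_pos hz
  have h1 := dedekindEta_ne_zero hz
  have h2 := dedekindEta_ne_zero (im_five_mul_pos hz)
  have h3 := Complex.I_ne_zero
  rw [psi5, psi5, show 5 * (-1 / (5 * z)) = -1 / z by field_simp, div_pow, div_pow,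
    dedekindEta_pow_six_neg_inv hz, dedekindEta_pow_six_neg_inv (im_five_mul_pos hz)]
  field_simp
  norm_num

theorem psi5_neg_inv_add_intCast_div_five {z : ℂ} (hz : 0 < z.im) {k l : ℤ}
    (h : dedekindEta ((-1 / z + k) / 5) ^ 6
      = Complex.I ^ (k + 1 - l) * z ^ 3 * dedekindEta ((z + l) / 5) ^ 6) :
    psi5 ((-1 / z + k) / 5) = psi5 ((z + l) / 5) := by
  have h0 := ne_zero_of_im_pos hz
  have h1 := dedekindEta_ne_zero hz
  have h3 := Complex.I_ne_zero
  have h5 : (5 : ℂ) ≠ 0 := by norm_num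
  rw [psi5, psi5, div_pow, div_pow, mul_div_cancel₀ _ h5, mul_div_cancel₀ _ h5,
    dedekindEta_pow_six_add_intCast, dedekindEta_pow_six_add_intCast,
    dedekindEta_pow_six_neg_inv hz, h, zpow_sub₀ h3, zpow_add₀ h3, zpow_one]
  field_simp

theorem im_add_intCast_pos {z : ℂ} (hz : 0 < z.im) (k : ℤ) : 0 < (z + k).im := by
  simpa using hz

theorem psi5_neg_inv_add_div_five_of_sq_eq_one {z : ℂ} (hz : 0 < z.im) {k : ℤ} (hk : k ^ 2 = 1) :
    psi5 ((-1 / z + k) / 5) = psi5 ((z + (-k : ℤ)) / 5) := by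
  refine psi5_neg_inv_add_intCast_div_five hz ?_
  have hw := im_add_intCast_div_five_pos hz (-k)
  have hb := im_add_intCast_pos (im_neg_inv_pos hw) (-5 * k)
  have hw0 := ne_zero_of_im_pos hw
  have hb0 := ne_zero_of_im_pos hb
  have hz0 := ne_zero_of_im_pos hz
  have hkc : (k : ℂ) ^ 2 = 1 := by exact_mod_cast hk
  have hbw : (-1 / ((z + (-k : ℤ)) / 5) + (-5 * k : ℤ)) * ((z + (-k : ℤ)) / 5) = -k * z := by
    rw [add_mul, div_mul_cancel₀ _ hw0]
    push_cast
    linear_combination hkc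
  have ha : (-1 / z + k) / 5 = -1 / (-1 / ((z + (-k : ℤ)) / 5) + (-5 * k : ℤ)) := by
    rw [eq_div_iff hb0]
    refine mul_right_cancel₀ hw0 ?_
    rw [mul_assoc, hbw]
    push_cast
    field_simp
    linear_combination (-z) * hkc
  rw [ha, dedekindEta_pow_six_neg_inv hb, dedekindEta_pow_six_add_intCast,
    dedekindEta_pow_six_neg_inv hw]
  generalize dedekindEta ((z + (-k : ℤ)) / 5) ^ 6 = g
  have hc := congrArg (· ^ 3) hbw
  simp only [mul_pow] at hc
  have hI : Complex.I * Complex.I ^ (-5 * k) * Complex.I * (-k) ^ 3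
      = Complex.I ^ (k + 1 - -k) := by
    have hk' : k = 1 ∨ k = -1 := by
      have : (k - 1) * (k + 1) = 0 := by linear_combination hk
      rcases mul_eq_zero.mp this with h | h <;> omega
    rcases hk' with rfl | rfl
    · rw [Complex.I_zpow_eq_zpow_mod, Complex.I_zpow_eq_zpow_mod (1 + 1 - -1)]
      norm_num [zpow_ofNat, Complex.I_pow_three]
    · rw [Complex.I_zpow_eq_zpow_mod, Complex.I_zpow_eq_zpow_mod (-1 + 1 - -(-1))]
      norm_num [zpow_ofNat, Complex.I_pow_three]
  linear_combination (Complex.I * Complex.I ^ (-5 * k) * Complex.I * g) * hc + z ^ 3 * g * hI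

theorem psi5_neg_inv_add_div_five_of_sq_eq_four {z : ℂ} (hz : 0 < z.im) {k : ℤ} (hk : k ^ 2 = 4) :
    psi5 ((-1 / z + k) / 5) = psi5 ((z + k) / 5) := by
  refine psi5_neg_inv_add_intCast_div_five hz ?_
  have hw := im_add_intCast_div_five_pos hz k
  have hd := im_add_intCast_pos (im_neg_inv_pos hw) k
  have hb := im_add_intCast_pos (im_neg_inv_pos hd) (-k)
  have hz0 := ne_zero_of_im_pos hz
  have hkc : (k : ℂ) ^ 2 = 4 := by exact_mod_cast hk
  have hw0 := ne_zero_of_im_pos hw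
  have hd0 := ne_zero_of_im_pos hd
  have hb0 := ne_zero_of_im_pos hb
  have hdw : (-1 / ((z + k) / 5) + k) * ((z + k) / 5) = -1 + k * ((z + k) / 5) := by
    rw [add_mul, div_mul_cancel₀ _ hw0]
  have hbdw : (-1 / (-1 / ((z + k) / 5) + k) + (-k : ℤ)) *
      ((-1 / ((z + k) / 5) + k) * ((z + k) / 5)) = -z := by
    rw [← mul_assoc, add_mul, div_mul_cancel₀ _ hd0, add_mul, mul_assoc, hdw]
    push_cast
    linear_combination (-(z + k) / 5) * hkc
  have ha : (-1 / z + k) / 5 = -1 / (-1 / (-1 / ((z + k) / 5) + k) + (-k : ℤ)) := by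
    rw [eq_div_iff hb0]
    refine mul_right_cancel₀ (mul_ne_zero hd0 hw0) ?_
    rw [mul_assoc, hbdw, hdw]
    field_simp
    linear_combination hkc
  rw [ha, dedekindEta_pow_six_neg_inv hb, dedekindEta_pow_six_add_intCast,
    dedekindEta_pow_six_neg_inv hd, dedekindEta_pow_six_add_intCast,
    dedekindEta_pow_six_neg_inv hw]
  generalize dedekindEta ((z + k) / 5) ^ 6 = g
  have hc := congrArg (· ^ 3) hbdw
  simp only [mul_pow] at hc
  have hI : Complex.I ^ (-k) * Complex.I ^ k = 1 := by
    rw [← zpow_add₀ Complex.I_ne_zero]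
    simp
  rw [show k + 1 - k = 1 by ring, zpow_one]
  linear_combination (Complex.I ^ 3 * Complex.I ^ (-k) * Complex.I ^ k * g) * hc
    - Complex.I ^ 3 * z ^ 3 * g * hI - Complex.I * z ^ 3 * g * Complex.I_sq

/-! ### Level one invariance -/

theorem E4_eq_E (z : ℍ) : E4 z = ModularForm.E (k := 4) (by norm_num) z := by
  rw [EisensteinSeries.q_expansion_bernoulli (by norm_num) (by decide)]
  simp_rw [zpow_natCast]
  rw [tsum_pnat_eq_tsum_succ (f := fun n =>
    (ArithmeticFunction.sigma (4 - 1) n : ℂ) * Complex.exp (2 * Real.pi * Complex.I * z) ^ n)]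
  have hb : bernoulli 4 = -1 / 30 := by norm_num [bernoulli, bernoulli'_four]
  rw [hb, E4]
  simp only [ArithmeticFunction.sigma_apply, sigma', qq]
  push_cast
  ring

theorem E4_neg_inv (z : ℍ) : E4 (-1 / z) = z ^ 4 * E4 z := by
  have h := congrFun (SlashInvariantForm.slash_action_eqn
    (ModularForm.E (k := 4) (by norm_num)) _ ⟨ModularGroup.S, rfl⟩) z
  have h' := (SlashInvariantForm.slash_S_apply (ModularForm.E (k := 4) (by norm_num)) 4
    z).symm.trans h
  rw [← E4_eq_E, ← E4_eq_E] at h'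
  have hz := z.ne_zero
  rw [show (-1 / z : ℂ) = (-z : ℂ)⁻¹ by rw [neg_div, one_div, inv_neg], ← h']
  field_simp

theorem jfun_neg_inv {z : ℂ} (hz : 0 < z.im) : jfun (-1 / z) = jfun z := by
  have h0 := ne_zero_of_im_pos hz
  have h : ∀ w, dedekindEta w ^ 24 = (dedekindEta w ^ 6) ^ 4 := fun w => by rw [← pow_mul]
  have hE : E4 (-1 / z) = z ^ 4 * E4 z := E4_neg_inv ⟨z, hz⟩
  rw [jfun, jfun, Δfun, Δfun, hE, h, dedekindEta_pow_six_neg_inv hz, mul_pow _ (_ ^ 6), mul_pow,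
    mul_pow Complex.I, Complex.I_pow_four, ← h, one_mul, ← pow_mul, ← pow_mul,
    mul_div_mul_left _ _ (pow_ne_zero _ h0)]

theorem differentiableOn_E4 : DifferentiableOn ℂ E4 {z | 0 < z.im} := by
  have h := UpperHalfPlane.mdifferentiable_iff.mp
    (ModularForm.E (k := 4) (by norm_num)).holo'
  refine h.congr fun z hz => ?_
  have := E4_eq_E ⟨z, hz⟩
  rw [Function.comp_apply, ofComplex_apply_of_im_pos hz]
  exact this

theorem differentiableOn_dedekindEta : DifferentiableOn ℂ dedekindEta {z | 0 < z.im} := by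
  rw [funext dedekindEta_eq_eta]
  exact fun z hz =>
    (ModularForm.differentiableAt_eta_of_mem_upperHalfPlaneSet hz).differentiableWithinAt

theorem differentiableOn_jfun : DifferentiableOn ℂ jfun {z | 0 < z.im} :=
  (differentiableOn_E4.pow 3).div (differentiableOn_dedekindEta.pow 24)
    fun _ hz => pow_ne_zero _ (dedekindEta_ne_zero hz)

theorem differentiableOn_psi5 : DifferentiableOn ℂ psi5 {z | 0 < z.im} :=
  (differentiableOn_dedekindEta.div (differentiableOn_dedekindEta.comp (by fun_prop)
    fun _ hz => im_five_mul_pos hz) fun _ hz => dedekindEta_ne_zero (im_five_mul_pos hz)).pow 6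

theorem DifferentiableOn.levelFiveMap {f : ℂ → ℂ} {s : Set ℂ} (hf : DifferentiableOn ℂ f s)
    (h : ∀ z ∈ s, f z ≠ 0) : DifferentiableOn ℂ (fun z => levelFiveMap (f z)) s :=
  ((((hf.pow 2).add (hf.const_mul 250)).add_const 3125).pow 3).div (hf.pow 5)
    fun z hz => pow_ne_zero _ (h z hz)

/-- The discrepancy `j - P(t)` for the value `t` of the level `5` Hauptmodul. -/
noncomputable def discrepancyInfty (z : ℂ) : ℂ := jfun z - levelFiveMap (psi5 z)

/-- The discrepancy `j - P(t)` for the conjugates of the Hauptmodul at the cusp `0`. -/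
noncomputable def discrepancyZero (k : ℤ) (z : ℂ) : ℂ :=
  jfun z - levelFiveMap (125 / psi5 ((z + k) / 5))

theorem differentiableOn_discrepancyInfty :
    DifferentiableOn ℂ discrepancyInfty {z | 0 < z.im} :=
  differentiableOn_jfun.sub (differentiableOn_psi5.levelFiveMap fun _ hz => psi5_ne_zero hz)

theorem differentiableOn_discrepancyZero (k : ℤ) :
    DifferentiableOn ℂ (discrepancyZero k) {z | 0 < z.im} := by
  have hpsi : DifferentiableOn ℂ (fun z => psi5 ((z + k) / 5)) {z | 0 < z.im} :=
    differentiableOn_psi5.comp (by fun_prop) fun _ hz => im_add_intCast_div_five_pos hz k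
  have h0 : ∀ z : ℂ, 0 < z.im → psi5 ((z + k) / 5) ≠ 0 := fun z hz =>
    psi5_ne_zero (im_add_intCast_div_five_pos hz k)
  exact differentiableOn_jfun.sub (DifferentiableOn.levelFiveMap
    ((differentiableOn_const 125).div hpsi h0) fun z hz => div_ne_zero (by norm_num) (h0 z hz))

theorem discrepancyInfty_add_one (z : ℂ) : discrepancyInfty (z + 1) = discrepancyInfty z := by
  have h1 := jfun_add_intCast z 1
  have h2 := psi5_add_intCast z 1
  rw [Int.cast_one] at h1 h2
  rw [discrepancyInfty, discrepancyInfty, h1, h2]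

theorem discrepancyZero_add_one (k : ℤ) (z : ℂ) :
    discrepancyZero k (z + 1) = discrepancyZero (k + 1) z := by
  have h1 := jfun_add_intCast z 1
  rw [Int.cast_one] at h1
  rw [discrepancyZero, discrepancyZero, h1]
  push_cast
  ring_nf

theorem discrepancyZero_add_five (k : ℤ) (z : ℂ) :
    discrepancyZero (k + 5) z = discrepancyZero k z := by
  have h := psi5_add_intCast ((z + k) / 5) 1
  rw [discrepancyZero, discrepancyZero, ← h]
  push_cast
  ring_nf

theorem discrepancyInfty_neg_inv {z : ℂ} (hz : 0 < z.im) :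
    discrepancyInfty (-1 / z) = discrepancyZero 0 z := by
  have hz5 := im_add_intCast_div_five_pos hz 0
  rw [discrepancyInfty, discrepancyZero, jfun_neg_inv hz, ← psi5_neg_inv_five_mul hz5]
  congr 3
  push_cast
  ring

theorem discrepancyZero_zero_neg_inv {z : ℂ} (hz : 0 < z.im) :
    discrepancyZero 0 (-1 / z) = discrepancyInfty z := by
  rw [discrepancyInfty, discrepancyZero, jfun_neg_inv hz,
    show (-1 / z + (0 : ℤ)) / 5 = -1 / (5 * z) by push_cast; ring, psi5_neg_inv_five_mul hz,
    div_div_cancel₀ (by norm_num)]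

theorem discrepancyZero_neg_inv_of_sq_eq_one {z : ℂ} (hz : 0 < z.im) {k : ℤ} (hk : k ^ 2 = 1) :
    discrepancyZero k (-1 / z) = discrepancyZero (-k) z := by
  rw [discrepancyZero, discrepancyZero, jfun_neg_inv hz,
    psi5_neg_inv_add_div_five_of_sq_eq_one hz hk]

theorem discrepancyZero_neg_inv_of_sq_eq_four {z : ℂ} (hz : 0 < z.im) {k : ℤ} (hk : k ^ 2 = 4) :
    discrepancyZero k (-1 / z) = discrepancyZero k z := by
  rw [discrepancyZero, discrepancyZero, jfun_neg_inv hz,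
    psi5_neg_inv_add_div_five_of_sq_eq_four hz hk]

/-- The characteristic polynomial, evaluated at `x`, of the discrepancies. -/
noncomputable def discrepancyCharpoly (x z : ℂ) : ℂ :=
  (x - discrepancyInfty z) * (x - discrepancyZero (-2) z) * (x - discrepancyZero (-1) z) *
    (x - discrepancyZero 0 z) * (x - discrepancyZero 1 z) * (x - discrepancyZero 2 z)

theorem discrepancyCharpoly_add_one (x z : ℂ) :
    discrepancyCharpoly x (z + 1) = discrepancyCharpoly x z := by
  simp only [discrepancyCharpoly, discrepancyInfty_add_one, discrepancyZero_add_one]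
  rw [show (2 : ℤ) + 1 = -2 + 5 by norm_num, discrepancyZero_add_five]
  norm_num
  ring

theorem discrepancyCharpoly_neg_inv (x : ℂ) {z : ℂ} (hz : 0 < z.im) :
    discrepancyCharpoly x (-1 / z) = discrepancyCharpoly x z := by
  rw [discrepancyCharpoly, discrepancyCharpoly, discrepancyInfty_neg_inv hz,
    discrepancyZero_zero_neg_inv hz, discrepancyZero_neg_inv_of_sq_eq_one hz (k := 1) (by norm_num),
    discrepancyZero_neg_inv_of_sq_eq_one hz (k := -1) (by norm_num),
    discrepancyZero_neg_inv_of_sq_eq_four hz (k := 2) (by norm_num),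
    discrepancyZero_neg_inv_of_sq_eq_four hz (k := -2) (by norm_num)]
  rw [neg_neg]
  ring

theorem tendsto_discrepancyCharpoly (x : ℂ) :
    Tendsto (fun z : ℍ => discrepancyCharpoly x z) atImInfty (𝓝 (x ^ 6)) := by
  have h1 := tendsto_jfun_sub_levelFiveMap_infty.const_sub x
  have h2 := fun k => (tendsto_jfun_sub_levelFiveMap_zero k).const_sub x
  have h := ((((h1.mul (h2 (-2))).mul (h2 (-1))).mul (h2 0)).mul (h2 1)).mul (h2 2)
  convert! h using 2
  ring

theorem discrepancyCharpoly_slash (x : ℂ) (γ : Matrix.SpecialLinearGroup (Fin 2) ℤ) :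
    SlashAction.map (0 : ℤ) γ (fun z : ℍ => discrepancyCharpoly x z) =
      fun z : ℍ => discrepancyCharpoly x z := by
  refine SlashInvariantForm.slash_action_generators_SL2Z ?_ ?_ γ
  · ext z
    rw [SlashInvariantForm.slash_S_apply, neg_zero, zpow_zero, mul_one,
      ← discrepancyCharpoly_neg_inv x z.im_pos, UpperHalfPlane.coe_mk, neg_div, one_div, inv_neg]
  · ext z
    rw [ModularForm.SL_slash_apply, UpperHalfPlane.modular_T_smul, neg_zero, zpow_zero, mul_one,
      ← discrepancyCharpoly_add_one x z, UpperHalfPlane.coe_vadd, add_comm]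
    norm_num

/-- The characteristic polynomial of the discrepancies as a modular form of level one. -/
noncomputable def discrepancyForm (x : ℂ) :
    ModularForm (Matrix.SpecialLinearGroup.mapGL (R := ℤ) (n := Fin 2) ℝ).range 0 where
  toFun z := discrepancyCharpoly x z
  slash_action_eq' := fun _ ⟨γ, hγ⟩ => hγ ▸ discrepancyCharpoly_slash x γ
  holo' := by
    refine UpperHalfPlane.mdifferentiable_iff.mpr ?_
    have h1 := differentiableOn_discrepancyInfty.const_sub x
    have h2 := fun k => (differentiableOn_discrepancyZero k).const_sub x
    refine (((((h1.mul (h2 (-2))).mul (h2 (-1))).mul (h2 0)).mul (h2 1)).mul (h2 2)).congr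
      fun z hz => ?_
    simp [discrepancyCharpoly, ofComplex_apply_of_im_pos hz]
  bdd_at_cusps' {c} hc := by
    rw [Subgroup.IsArithmetic.isCusp_iff_isCusp_SL2Z] at hc
    rw [OnePoint.isBoundedAt_iff_forall_SL2Z hc]
    intro γ _
    rw [discrepancyCharpoly_slash x γ]
    exact (tendsto_discrepancyCharpoly x).isBigO_one ℝ

theorem discrepancyCharpoly_eq (x : ℂ) (z : ℍ) : discrepancyCharpoly x z = x ^ 6 := by
  obtain ⟨c, hc⟩ := ModularFormClass.levelOne_weight_zero_const (discrepancyForm x)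
  have h : ∀ w : ℍ, discrepancyCharpoly x w = c := fun w => congrFun hc w
  have h1 := tendsto_discrepancyCharpoly x
  simp only [h] at h1 ⊢
  exact tendsto_nhds_unique tendsto_const_nhds h1

theorem discrepancyInfty_eq_zero (z : ℍ) : discrepancyInfty z = 0 := by
  have h := discrepancyCharpoly_eq (discrepancyInfty z) z
  rw [discrepancyCharpoly, sub_self] at h
  simpa using h.symm

/-- `j = ψ⁵ + 750 + 196875 φ⁵ + 20312500 (φ⁵)² + 615234375 (φ⁵)³
    + 7324218750 (φ⁵)⁴ + 30517578125 (φ⁵)⁵`. -/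
theorem j_eq_level5 : ∀ z : ℍ, jfun z = psi5 z + 750 + 196875 * phi5 z
    + 20312500 * phi5 z ^ 2 + 615234375 * phi5 z ^ 3
    + 7324218750 * phi5 z ^ 4 + 30517578125 * phi5 z ^ 5 := by
  intro z
  have h0 := psi5_ne_zero z.im_pos
  rw [sub_eq_zero.mp (discrepancyInfty_eq_zero z), levelFiveMap, phi5]
  field_simp
  ring
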